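/- The map t ↦ Φ_t^{213} is a bijection from the set 𝔗_{n+1} of rooted ordered trees with n+1 vertices to the set Av_n(213) of permutations of [n] avoiding 213, where for t ∈ 𝔗_{n+1} with vertices v_0, v_1, …, v_n listed in increasing lexicographic order (v_0 = ∅ the root), Φ_t^{213}(i) = |t ∖ t_{v_i}| − i + |v_i| for i = 1, …, n, with t_{v_i} the fringe subtree of t at v_i and |v_i| the height of v_i. -/

import Mathlib

open Set Filter MeasureTheory Topology TopologicalSpace
open scoped ENNReal

namespace AvoidPaper

/-- Instances for the codomain `ℕ∞` (one-point compactification of `ℕ`). -/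
instance : SecondCountableTopology ℕ∞ := by
  have h : ({s : Set ℕ∞ | ∃ a, s = Set.Ioi a ∨ s = Set.Iio a}).Countable := by
    have hsub : {s : Set ℕ∞ | ∃ a, s = Set.Ioi a ∨ s = Set.Iio a}
        ⊆ Set.range (Set.Ioi : ℕ∞ → Set ℕ∞) ∪ Set.range (Set.Iio : ℕ∞ → Set ℕ∞) := by
      rintro s ⟨a, rfl | rfl⟩
      · exact Or.inl ⟨a, rfl⟩
      · exact Or.inr ⟨a, rfl⟩
    exact ((Set.countable_range _).union (Set.countable_range _)).mono hsub
  exact SecondCountableTopology.mk' h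

instance : OpensMeasurableSpace ℕ∞ := ⟨le_top⟩

/-! ## Ulam–Harris vertices and rooted ordered trees -/

/-- A vertex of the Ulam–Harris tree: a finite list of natural numbers (children indices),
ordered lexicographically (so an ancestor precedes its descendants). -/
abbrev Vertex : Type := List ℕ

/-- A (rooted ordered) tree: contains the root, is closed under ancestors, and is
left-closed among siblings. -/
def IsTree (t : Set Vertex) : Prop :=
  ([] : Vertex) ∈ t ∧ (∀ u v : Vertex, u ++ v ∈ t → u ∈ t) ∧
    ∀ (u : Vertex) (i j : ℕ), u ++ [i] ∈ t → j ≤ i → u ++ [j] ∈ t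

/-- The set of children indices of `u` in `t`. -/
def children (t : Set Vertex) (u : Vertex) : Set ℕ := {i | u ++ [i] ∈ t}

/-- Locally finite tree. -/
def LocFin (t : Set Vertex) : Prop := ∀ u : Vertex, (children t u).Finite

/-- Number of children of `u` in `t`. -/
noncomputable def childCount (t : Set Vertex) (u : Vertex) : ℕ := (children t u).ncard

/-- The degree function `d_t(u)`: number of children, and `-1` if `u ∉ t`. -/
noncomputable def deg (t : Set Vertex) (u : Vertex) : ℤ :=
  haveI := Classical.dec (u ∈ t)
  if u ∈ t then (childCount t u : ℤ) else -1

/-- `t^[m]`: restriction of `t` to the vertices of height at most `m`. -/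
def trunc (t : Set Vertex) (m : ℕ) : Set Vertex := {u ∈ t | u.length ≤ m}

/-- Local convergence of trees: `d_{t_n}(u) → d_t(u)` for every vertex `u`
(equivalently, eventual equality, since degrees are integers). -/
def LocalConv (ts : ℕ → Set Vertex) (t : Set Vertex) : Prop :=
  ∀ u : Vertex, ∀ᶠ n in atTop, deg (ts n) u = deg t u

/-- A leaf: a vertex of `t` with no children. -/
def IsLeaf (t : Set Vertex) (v : Vertex) : Prop := v ∈ t ∧ ∀ i : ℕ, v ++ [i] ∉ t

def leafSet (t : Set Vertex) : Set Vertex := {v | IsLeaf t v}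

/-- The fringe subtree `t_v` of `t` at `v` (as a subset of `t`). -/
def fringe (t : Set Vertex) (v : Vertex) : Set Vertex := {x ∈ t | v <+: x}

/-- Number of vertices of `t` at height exactly `k`. -/
noncomputable def levelCount (t : Set Vertex) (k : ℕ) : ℕ := {u ∈ t | u.length = k}.ncard

/-- An infinite spine of `t`: `η 0` is the root and `η (i+1)` is a child of `η i`. -/
def IsSpine (t : Set Vertex) (η : ℕ → Vertex) : Prop :=
  η 0 = [] ∧ (∀ i, η i ∈ t) ∧ ∀ i, ∃ c : ℕ, η (i + 1) = η i ++ [c]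

/-- `v` lies strictly to the left of the spine `η`. -/
def LeftOfSpine (t : Set Vertex) (η : ℕ → Vertex) (v : Vertex) : Prop :=
  v ∈ t ∧ (∀ i, η i ≠ v) ∧ ∃ j, v < η j

/-- `v` lies strictly to the right of the spine `η`. -/
def RightOfSpine (t : Set Vertex) (η : ℕ → Vertex) (v : Vertex) : Prop :=
  v ∈ t ∧ ∀ j, η j < v

/-- `η` is the unique infinite spine of `t`, with infinitely many subtrees attached to
the left and to the right of the spine, infinitely many of the left ones having at
least two vertices. -/
def SpineSpec (t : Set Vertex) (η : ℕ → Vertex) : Prop :=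
  IsSpine t η ∧ (∀ η', IsSpine t η' → η' = η) ∧
  {u : Vertex | (∃ k c, u = η k ++ [c]) ∧ LeftOfSpine t η u}.Infinite ∧
  {u : Vertex | (∃ k c, u = η k ++ [c]) ∧ RightOfSpine t η u}.Infinite ∧
  {u : Vertex | (∃ k c, u = η k ++ [c]) ∧ LeftOfSpine t η u ∧
      2 ≤ (fringe t u).encard}.Infinite

/-- `𝔗_f`: finite trees with at least two vertices. -/
def MemTf (t : Set Vertex) : Prop := IsTree t ∧ t.Finite ∧ 2 ≤ t.encard

/-- `𝔗_∞`. -/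
def MemTinf (t : Set Vertex) : Prop :=
  IsTree t ∧ LocFin t ∧ t.Infinite ∧ ∃ η : ℕ → Vertex, SpineSpec t η

/-- The leaves of `t` lying to the left of the spine `η`. -/
def leftLeaves (t : Set Vertex) (η : ℕ → Vertex) : Set Vertex :=
  {x | IsLeaf t x ∧ LeftOfSpine t η x}

/-- `v` is the enumeration `(v_{t,i})` of (an initial part of) `t` in increasing
lexicographic order: `v i ∈ t` and the vertices of `t` smaller than `v i` are
exactly `v 0, …, v (i-1)`. -/
def IsLexEnum (t : Set Vertex) (v : ℕ → Vertex) : Prop :=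
  ∀ i : ℕ, (i : ℕ∞) < t.encard →
    v i ∈ t ∧ {x ∈ t | x < v i} = v '' {j | j < i}

/-- `w` is the enumeration `(w_{t,i})` of (a final part of) `t` in decreasing
lexicographic order, starting from the lexicographically largest vertex. -/
def IsLexCoEnum (t : Set Vertex) (w : ℕ → Vertex) : Prop :=
  ∀ i : ℕ, (i : ℕ∞) < t.encard →
    w i ∈ t ∧ {x ∈ t | w i < x} = w '' {j | j < i}

/-- `l` enumerates the set `A` in increasing lexicographic order. -/
def IsEnumOf (A : Set Vertex) (l : ℕ → Vertex) : Prop :=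
  ∀ i : ℕ, (i : ℕ∞) < A.encard →
    l i ∈ A ∧ {x ∈ A | x < l i} = l '' {j | j < i}

/-- `s_i`: the number of vertices of `t` lexicographically smaller than the `i`-th leaf
(0-indexed: `l 0` is the paper's `l_1`). -/
noncomputable def sVal (t : Set Vertex) (l : ℕ → Vertex) (i : ℕ) : ℕ :=
  {x ∈ t | x < l i}.ncard

/-- `p_i`: the height of the `i`-th leaf. -/
def pVal (l : ℕ → Vertex) (i : ℕ) : ℕ := (l i).length

/-! ## The maps Φ^σ -/

/-- `Φ^{231}` as an element of `F(ℕ, ℕ*)` (value `i` outside the range of indices). -/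
noncomputable def phi231 (t : Set Vertex) (v : ℕ → Vertex) : ℕ → ℕ∞ := fun i =>
  if 1 ≤ i ∧ (i : ℕ∞) < t.encard then
    ((i : ℕ∞) + (fringe t (v i)).encard) - ((v i).length : ℕ∞)
  else (i : ℕ∞)

noncomputable def phi213 (t : Set Vertex) (v : ℕ → Vertex) : ℕ → ℕ∞ := fun i =>
  if 1 ≤ i ∧ (i : ℕ∞) < t.encard then
    ((t \ fringe t (v i)).encard + ((v i).length : ℕ∞)) - (i : ℕ∞)
  else (i : ℕ∞)

noncomputable def phi312 (t : Set Vertex) (w : ℕ → Vertex) : ℕ → ℕ∞ := fun i =>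
  if 1 ≤ i ∧ (i : ℕ∞) < t.encard then
    ((i : ℕ∞) + ((w (i - 1)).length : ℕ∞)) - (fringe t (w (i - 1))).encard
  else (i : ℕ∞)

noncomputable def phi132 (t : Set Vertex) (w : ℕ → Vertex) : ℕ → ℕ∞ := fun i =>
  if 1 ≤ i ∧ (i : ℕ∞) < t.encard then
    ((t.encard + (fringe t (w (i - 1))).encard) - (i : ℕ∞)) - ((w (i - 1)).length : ℕ∞)
  else (i : ℕ∞)

/-- `B = {s_i - p_i + 1 : i}` (with `i` ranging over indices `< L` of leaves). -/
def Bset (S P : ℕ → ℕ) (L : ℕ∞) : Set ℕ :=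
  {b | ∃ i : ℕ, (i : ℕ∞) < L ∧ S i - P i + 1 = b}

/-- `A = {s_i : i}`. -/
def Aset (S : ℕ → ℕ) (L : ℕ∞) : Set ℕ := {a | ∃ i : ℕ, (i : ℕ∞) < L ∧ S i = a}

/-- The number of elements of `C` in `{1, …, j}`. -/
noncomputable def rankIn (C : Set ℕ) (j : ℕ) : ℕ := (C ∩ Set.Icc 1 j).ncard

/-- The `a`-th smallest positive element of `C`. -/
noncomputable def nthOf (C : Set ℕ) (a : ℕ) : ℕ :=
  sInf {m : ℕ | a ≤ (C ∩ Set.Icc 1 m).ncard}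

open Classical in
/-- `Φ^{321}` built from the data `s, p` (and the number `L` of leaves):
`s_i - p_i + 1 ↦ s_i`, extended by the unique increasing bijection between the
complements (and by the identity outside `[1, n]` in the finite case). -/
noncomputable def phi321Fun (S P : ℕ → ℕ) (L : ℕ∞) : ℕ → ℕ∞ := fun j =>
  if h : j ∈ Bset S P L then (S h.choose : ℕ∞)
  else (nthOf (Aset S L)ᶜ (rankIn (Bset S P L)ᶜ j) : ℕ∞)

/-- `Φ^{123} = |t| + 1 - Φ^{321}` as an element of `F(ℕ, ℕ*)`. -/
noncomputable def phi123Fun (tc : ℕ∞) (f : ℕ → ℕ∞) : ℕ → ℕ∞ := fun j =>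
  if 1 ≤ j ∧ (j : ℕ∞) < tc then (tc + 1) - f j else (j : ℕ∞)

/-! ## Patterns and pattern avoidance -/

def p123 : Equiv.Perm (Fin 3) := Equiv.refl _
noncomputable def p321 : Equiv.Perm (Fin 3) := Equiv.ofBijective ![2, 1, 0] (by decide)
noncomputable def p231 : Equiv.Perm (Fin 3) := Equiv.ofBijective ![1, 2, 0] (by decide)
noncomputable def p213 : Equiv.Perm (Fin 3) := Equiv.ofBijective ![1, 0, 2] (by decide)
noncomputable def p312 : Equiv.Perm (Fin 3) := Equiv.ofBijective ![2, 0, 1] (by decide)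
noncomputable def p132 : Equiv.Perm (Fin 3) := Equiv.ofBijective ![0, 2, 1] (by decide)

/-- `π` contains the length-3 pattern `σ`. -/
def ContainsPat {n : ℕ} (π : Equiv.Perm (Fin n)) (σ : Equiv.Perm (Fin 3)) : Prop :=
  ∃ f : Fin 3 → Fin n, StrictMono f ∧ ∀ j k : Fin 3, σ j < σ k ↔ π (f j) < π (f k)

/-- `π` avoids the length-3 pattern `σ`. -/
def AvoidsPat {n : ℕ} (π : Equiv.Perm (Fin n)) (σ : Equiv.Perm (Fin 3)) : Prop :=
  ¬ ContainsPat π σ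

/-- Trees with `n+1` vertices. -/
def TreeN (n : ℕ) : Type := {t : Set Vertex // IsTree t ∧ t.encard = (n : ℕ∞) + 1}

/-- Embedding of a permutation of `[n]` into `F(ℕ, ℕ*)` by `π(k) = k` for `k > n`
(permutations are `1`-indexed: position `k ∈ [1, n]` corresponds to `k - 1 : Fin n`). -/
noncomputable def embedPerm {n : ℕ} (π : Equiv.Perm (Fin n)) : ℕ → ℕ∞ := fun k =>
  if h : 1 ≤ k ∧ k ≤ n then (((π ⟨k - 1, by omega⟩ : Fin n) : ℕ) + 1 : ℕ) else (k : ℕ∞)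

/-- The (finite) set of permutations of `[n]` avoiding `σ`. -/
noncomputable def avoidFinset (σ : Equiv.Perm (Fin 3)) (n : ℕ) : Finset (Equiv.Perm (Fin n)) :=
  Set.Finite.toFinset (Set.toFinite {π : Equiv.Perm (Fin n) | AvoidsPat π σ})

/-- The law of a uniformly random `σ`-avoiding permutation of `[n]`,
as a measure on `F(ℕ, ℕ*)`. -/
noncomputable def uniformAvoidLaw (σ : Equiv.Perm (Fin 3)) (n : ℕ) : Measure (ℕ → ℕ∞) :=
  ((avoidFinset σ n).card : ℝ≥0∞)⁻¹ • ∑ π ∈ avoidFinset σ n, Measure.dirac (embedPerm π)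


open Classical in
/-- `Φ^σ` for an arbitrary pattern `σ ∈ S_3`, given a tree together with its increasing
vertex enumeration `v`, its decreasing vertex enumeration `w`, and the increasing
enumeration `l` of the relevant set `Lset` of leaves. -/
noncomputable def PhiOf (σ : Equiv.Perm (Fin 3)) (t : Set Vertex)
    (v w l : ℕ → Vertex) (Lset : Set Vertex) : ℕ → ℕ∞ :=
  if σ = p231 then phi231 t v
  else if σ = p213 then phi213 t v
  else if σ = p312 then phi312 t w
  else if σ = p132 then phi132 t w
  else if σ = p321 then phi321Fun (sVal t l) (pVal l) Lset.encard
  else phi123Fun t.encard (phi321Fun (sVal t l) (pVal l) Lset.encard)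

open Classical in
noncomputable def canonSpine (t : Set Vertex) : ℕ → Vertex :=
  if h : ∃ η : ℕ → Vertex, IsSpine t η then h.choose else fun _ => []

open Classical in
noncomputable def canonV (t : Set Vertex) : ℕ → Vertex :=
  if h : ∃ v : ℕ → Vertex, IsLexEnum t v then h.choose else fun _ => []

open Classical in
noncomputable def canonW (t : Set Vertex) : ℕ → Vertex :=
  if h : ∃ w : ℕ → Vertex, IsLexCoEnum t w then h.choose else fun _ => []

open Classical in
noncomputable def canonL (t : Set Vertex) : ℕ → Vertex :=
  if h : ∃ l : ℕ → Vertex, IsEnumOf (leftLeaves t (canonSpine t)) l then h.choose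
  else fun _ => []

/-- `Φ^σ_t` for an infinite tree `t ∈ 𝔗_∞`, using the canonical (unique) spine and
enumerations. -/
noncomputable def PhiCanon (σ : Equiv.Perm (Fin 3)) (t : Set Vertex) : ℕ → ℕ∞ :=
  PhiOf σ t (canonV t) (canonW t) (canonL t) (leftLeaves t (canonSpine t))

/-- σ-algebra on the space of trees: all sets are measurable. -/
instance : MeasurableSpace (Set Vertex) := ⊤

/-- `μ` is the law of a Galton–Watson tree with offspring distribution `ξ`:
a probability measure, supported on trees, giving each finite tree `t` the
probability `∏_{u ∈ t} ξ(d_t(u))`. -/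
def IsGW (ξ : ℕ → ℝ≥0∞) (μ : Measure (Set Vertex)) : Prop :=
  IsProbabilityMeasure μ ∧ μ {t | IsTree t} = 1 ∧
    ∀ t : Set Vertex, IsTree t → ∀ ht : t.Finite,
      μ {t} = ∏ u ∈ ht.toFinset, ξ (childCount t u)

/-- `π` is the permutation `Φ^{321}_t` of `[n]` associated to a finite tree `t` with
`n+1` vertices: for every leaf `v` with `s = #{x ∈ t : x < v}` and `p = |v|`, position
`s - p + 1` is mapped to `s` (in 0-indexed form: position `s - p` to value `s - 1`),
and `π` is increasing on the remaining positions. -/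
def Is321Image (n : ℕ) (t : Set Vertex) (π : Equiv.Perm (Fin n)) : Prop :=
  (∀ v : Vertex, IsLeaf t v →
    ∃ hb : {x ∈ t | x < v}.ncard - v.length < n,
      ((π ⟨{x ∈ t | x < v}.ncard - v.length, hb⟩ : Fin n) : ℕ)
        = {x ∈ t | x < v}.ncard - 1) ∧
  ∀ a b : Fin n, a < b →
    (∀ v : Vertex, IsLeaf t v → {x ∈ t | x < v}.ncard - v.length ≠ (a : ℕ)) →
    (∀ v : Vertex, IsLeaf t v → {x ∈ t | x < v}.ncard - v.length ≠ (b : ℕ)) →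
    π a < π b

/-- `π` is the permutation `Φ^{123}_t = (n+1) - Φ^{321}_t` of `[n]`. -/
def Is123Image (n : ℕ) (t : Set Vertex) (π : Equiv.Perm (Fin n)) : Prop :=
  ∃ π' : Equiv.Perm (Fin n), Is321Image n t π' ∧ ∀ i : Fin n, π i = Fin.rev (π' i)

theorem lt_append_cons (u : Vertex) (c : ℕ) (w : Vertex) : u < u ++ c :: w := by
  induction u with
  | nil => exact List.nil_lt_cons _ _
  | cons a u ih => simpa [List.cons_lt_cons_iff] using ih

theorem append_lt_append {a b : Vertex} (u : Vertex) (h : a < b) : u ++ a < u ++ b := by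
  induction u with
  | nil => exact h
  | cons c u ih => simpa [List.cons_lt_cons_iff] using ih

theorem lt_of_prefix_of_ne {u v : Vertex} (h : u <+: v) (hne : u ≠ v) : u < v := by
  obtain ⟨w, rfl⟩ := h
  cases w with
  | nil => simp at hne
  | cons c w => exact lt_append_cons u c w

theorem le_of_prefix {u v : Vertex} (h : u <+: v) : u ≤ v := by
  by_cases hne : u = v
  · exact hne.le
  · exact (lt_of_prefix_of_ne h hne).le

/-- The vertex with all child indices read in the dual order: its lexicographic order is the
right-to-left depth-first order. -/
def mirror (u : Vertex) : List ℕᵒᵈ := u.map OrderDual.toDual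

theorem mirror_injective : Function.Injective mirror :=
  List.map_injective_iff.2 OrderDual.toDual.injective

theorem mirror_lt_mirror_iff {x y : Vertex} :
    mirror y < mirror x ↔ (y <+: x ∧ y ≠ x) ∨ (x < y ∧ ¬ x <+: y) := by
  induction y generalizing x with
  | nil => cases x <;> simp [mirror]
  | cons b y ih =>
    cases x with
    | nil => simp [mirror]
    | cons a x =>
      have := @ih x
      simp only [mirror] at this
      simp only [mirror, List.map_cons, List.cons_lt_cons_iff, OrderDual.toDual_lt_toDual,
        this, List.cons_prefix_cons, EmbeddingLike.apply_eq_iff_eq, ne_eq, List.cons.injEq]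
      rcases lt_trichotomy a b with h | h | h
      · simp [h, h.ne, h.ne']
      · subst h; simp
      · simp [h.ne, h.ne', h.not_gt]

theorem mirror_lt_mirror_iff_of_lt {x y : Vertex} (h : x < y) :
    mirror x < mirror y ↔ x <+: y := by
  rw [mirror_lt_mirror_iff]
  exact ⟨fun h' => h'.elim And.left fun h' => absurd h'.1 h.not_gt, fun h' => Or.inl ⟨h', h.ne⟩⟩

/-- The rank of `u` among the non-root vertices of `t` in the right-to-left depth-first order. -/
noncomputable def mirrorRank (t : Set Vertex) (u : Vertex) : ℕ :=
  {x ∈ t | x ≠ [] ∧ mirror x ≤ mirror u}.ncard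

theorem mirrorRank_lt_iff {t : Set Vertex} (ht : t.Finite) {x y : Vertex} (hx : x ∈ t)
    (hy : y ∈ t) (hx0 : x ≠ []) (hy0 : y ≠ []) :
    mirrorRank t x < mirrorRank t y ↔ mirror x < mirror y := by
  have key : ∀ x y : Vertex, y ∈ t → y ≠ [] → mirror x < mirror y →
      mirrorRank t x < mirrorRank t y := by
    intro x y hy hy0 h
    refine Set.ncard_lt_ncard ?_ (ht.subset fun z hz => hz.1)
    refine ⟨fun z hz => ⟨hz.1, hz.2.1, hz.2.2.trans h.le⟩, fun hsub => ?_⟩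
    exact absurd (hsub ⟨hy, hy0, le_rfl⟩).2.2 h.not_ge
  refine ⟨fun h => ?_, key x y hy hy0⟩
  by_contra hlt
  rcases (not_lt.1 hlt).lt_or_eq with h' | h'
  · exact (key y x hx hx0 h').not_gt h
  · rw [mirror_injective h'] at h
    exact h.false

theorem ncard_nonroot_prefixes {t : Set Vertex} (ht : IsTree t) {u : Vertex} (hu : u ∈ t) :
    {x ∈ t | x ≠ [] ∧ x <+: u}.ncard = u.length := by
  have h : {x ∈ t | x ≠ [] ∧ x <+: u} = (fun k => u.take (k + 1)) '' Set.Iio u.length := by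
    ext x
    constructor
    · rintro ⟨-, hx0, hx⟩
      have hpos := List.length_pos_iff.2 hx0
      have hle := hx.length_le
      refine ⟨x.length - 1, by simp only [Set.mem_Iio]; omega, ?_⟩
      simp only [Nat.sub_add_cancel hpos]
      exact (List.prefix_iff_eq_take.1 hx).symm
    · rintro ⟨k, hk, rfl⟩
      have hk' : k < u.length := hk
      refine ⟨ht.2.1 _ (u.drop (k + 1)) (by simpa using hu), ?_, List.take_prefix _ _⟩
      refine List.length_pos_iff.1 ?_
      simp only [List.length_take]
      omega
  rw [h, Set.InjOn.ncard_image]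
  · simp [Set.ncard_eq_toFinset_card']
  · intro a ha b hb hab
    have ha' : a < u.length := ha
    have hb' : b < u.length := hb
    have := congrArg List.length hab
    simp only [List.length_take] at this
    omega

theorem ncard_diff_fringe_add_length {t : Set Vertex} (ht : IsTree t) (hf : t.Finite)
    {u : Vertex} (hu : u ∈ t) :
    (t \ fringe t u).ncard + u.length = mirrorRank t u + {x ∈ t | x < u}.ncard := by
  have hsub : ∀ p : Vertex → Prop, {x ∈ t | p x}.Finite := fun p => hf.subset fun x hx => hx.1
  have h1 : t \ fringe t u = {x ∈ t | x < u} ∪ {x ∈ t | u < x ∧ ¬ u <+: x} := by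
    ext x
    simp only [fringe, Set.mem_sdiff, Set.mem_ofPred_eq, Set.mem_union]
    constructor
    · rintro ⟨hx, hn⟩
      rcases lt_trichotomy x u with h | h | h
      · exact Or.inl ⟨hx, h⟩
      · exact absurd ⟨hx, h ▸ List.prefix_rfl⟩ hn
      · exact Or.inr ⟨hx, h, fun h' => hn ⟨hx, h'⟩⟩
    · rintro (⟨hx, h⟩ | ⟨hx, -, h⟩)
      · exact ⟨hx, fun h' => (le_of_prefix h'.2).not_gt h⟩
      · exact ⟨hx, fun h' => h h'.2⟩
  have h2 : {x ∈ t | x ≠ [] ∧ mirror x ≤ mirror u} =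
      {x ∈ t | x ≠ [] ∧ x <+: u} ∪ {x ∈ t | u < x ∧ ¬ u <+: x} := by
    ext x
    simp only [Set.mem_ofPred_eq, Set.mem_union, le_iff_lt_or_eq, mirror_lt_mirror_iff,
      mirror_injective.eq_iff]
    constructor
    · rintro ⟨hx, hx0, (⟨h, -⟩ | h) | h⟩
      · exact Or.inl ⟨hx, hx0, h⟩
      · exact Or.inr ⟨hx, h⟩
      · exact Or.inl ⟨hx, hx0, h ▸ List.prefix_rfl⟩
    · rintro (⟨hx, hx0, h⟩ | ⟨hx, h⟩)
      · by_cases hxu : x = u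
        · exact ⟨hx, hx0, Or.inr hxu⟩
        · exact ⟨hx, hx0, Or.inl (Or.inl ⟨h, hxu⟩)⟩
      · refine ⟨hx, ?_, Or.inl (Or.inr h)⟩
        rintro rfl
        exact List.not_lt_nil _ h.1
  have d1 : Disjoint {x ∈ t | x < u} {x ∈ t | u < x ∧ ¬ u <+: x} :=
    Set.disjoint_left.2 fun x hx hx' => hx.2.not_gt hx'.2.1
  have d2 : Disjoint {x ∈ t | x ≠ [] ∧ x <+: u} {x ∈ t | u < x ∧ ¬ u <+: x} :=
    Set.disjoint_left.2 fun x hx hx' => (le_of_prefix hx.2.2).not_gt hx'.2.1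
  rw [mirrorRank, h1, h2, Set.ncard_union_eq d1 (hsub _) (hsub _),
    Set.ncard_union_eq d2 (hsub _) (hsub _), ncard_nonroot_prefixes ht hu]
  omega

/-- `v 0 < v 1 < ⋯ < v n` are exactly the elements of `t`. -/
def Enumerates (n : ℕ) (t : Set Vertex) (v : ℕ → Vertex) : Prop :=
  (∀ i j, i < j → j ≤ n → v i < v j) ∧ t = v '' {j | j ≤ n}

section Enumerates

variable {n : ℕ} {t : Set Vertex} {v : ℕ → Vertex}

theorem Enumerates.lt_iff (h : Enumerates n t v) {i j : ℕ} (hi : i ≤ n) (hj : j ≤ n) :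
    v i < v j ↔ i < j := by
  refine ⟨fun hlt => ?_, fun hij => h.1 i j hij hj⟩
  by_contra hc
  rcases (not_lt.1 hc).lt_or_eq with h' | h'
  · exact (h.1 j i h' hi).not_gt hlt
  · exact absurd hlt (h' ▸ lt_irrefl _)

theorem Enumerates.injOn (h : Enumerates n t v) : Set.InjOn v {j | j ≤ n} := by
  intro i hi j hj hij
  have h1 := h.lt_iff hi hj
  have h2 := h.lt_iff hj hi
  simp only [hij, lt_irrefl, false_iff, not_lt] at h1 h2
  exact le_antisymm h2 h1

theorem Enumerates.mem (h : Enumerates n t v) {i : ℕ} (hi : i ≤ n) : v i ∈ t :=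
  h.2 ▸ ⟨i, hi, rfl⟩

theorem Enumerates.exists_index (h : Enumerates n t v) {x : Vertex} (hx : x ∈ t) :
    ∃ i ≤ n, v i = x := by
  rw [h.2] at hx
  exact hx

theorem Enumerates.finite (h : Enumerates n t v) : t.Finite :=
  h.2 ▸ (Set.finite_Iic n).image v

theorem Enumerates.encard_eq (h : Enumerates n t v) : t.encard = (n : ℕ∞) + 1 := by
  have h1 : t.encard = (Set.Iic n).encard := by
    rw [h.2]
    exact h.injOn.encard_image
  rw [h1, ← (Set.finite_Iic n).cast_ncard_eq, Set.ncard_eq_toFinset_card']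
  simp

theorem Enumerates.setOf_lt_eq (h : Enumerates n t v) {i : ℕ} (hi : i ≤ n) :
    {x ∈ t | x < v i} = v '' {j | j < i} := by
  ext x
  constructor
  · rintro ⟨hx, hlt⟩
    obtain ⟨j, hj, rfl⟩ := h.exists_index hx
    exact ⟨j, (h.lt_iff hj hi).1 hlt, rfl⟩
  · rintro ⟨j, hj, rfl⟩
    have hj' : j < i := hj
    exact ⟨h.mem (hj'.le.trans hi), h.1 j i hj' hi⟩

theorem Enumerates.ncard_setOf_lt (h : Enumerates n t v) {i : ℕ} (hi : i ≤ n) :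
    {x ∈ t | x < v i}.ncard = i := by
  rw [h.setOf_lt_eq hi, Set.InjOn.ncard_image (h.injOn.mono fun j hj => ?_)]
  · simp [Set.ncard_eq_toFinset_card']
  · exact le_trans (le_of_lt hj) hi

theorem Enumerates.isLexEnum (h : Enumerates n t v) : IsLexEnum t v := by
  intro i hi
  rw [h.encard_eq] at hi
  have hi' : i ≤ n := Nat.lt_succ_iff.1 (by exact_mod_cast hi)
  exact ⟨h.mem hi', h.setOf_lt_eq hi'⟩

theorem IsLexEnum.enumerates (h : IsLexEnum t v) (hc : t.encard = (n : ℕ∞) + 1) :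
    Enumerates n t v := by
  have hlt : ∀ i, i ≤ n → (i : ℕ∞) < t.encard := fun i hi => by
    rw [hc]
    exact_mod_cast Nat.lt_succ_iff.2 hi
  have hmono : ∀ i j, i < j → j ≤ n → v i < v j := by
    intro i j hij hj
    have hmem : v i ∈ {x ∈ t | x < v j} := by
      rw [(h j (hlt j hj)).2]
      exact ⟨i, hij, rfl⟩
    exact hmem.2
  have himage : Enumerates n (v '' {j | j ≤ n}) v := ⟨hmono, rfl⟩
  have hfin : t.Finite := Set.finite_of_encard_eq_coe (k := n + 1) (by exact_mod_cast hc)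
  have hsub : v '' {j | j ≤ n} ⊆ t := by
    rintro _ ⟨i, hi, rfl⟩
    exact (h i (hlt i hi)).1
  refine ⟨hmono, ((hfin.subset hsub).eq_of_subset_of_encard_le hsub ?_).symm⟩
  rw [hc, himage.encard_eq]

theorem exists_enumerates (hc : t.encard = (n : ℕ∞) + 1) : ∃ v, Enumerates n t v := by
  have hfin : t.Finite := Set.finite_of_encard_eq_coe (k := n + 1) (by exact_mod_cast hc)
  have hcard : hfin.toFinset.card = n + 1 := by
    have := hfin.encard_eq_coe_toFinset_card
    rw [hc] at this
    exact_mod_cast this.symm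
  let e := hfin.toFinset.orderEmbOfFin hcard
  have he : Set.range e = t := by simp [e]
  have hv : ∀ i (hi : i ≤ n), e (Fin.ofNat (n + 1) i) = e ⟨i, Nat.lt_succ_iff.2 hi⟩ := by
    intro i hi
    congr 1
    exact Fin.ext (Nat.mod_eq_of_lt (Nat.lt_succ_iff.2 hi))
  refine ⟨fun i => e (Fin.ofNat (n + 1) i), ?_, ?_⟩
  · intro i j hij hj
    simp only [hv i (hij.le.trans hj), hv j hj]
    exact e.strictMono hij
  · ext x
    rw [← he]
    constructor
    · rintro ⟨i, rfl⟩
      exact ⟨i, Nat.lt_succ_iff.1 i.2, hv i (Nat.lt_succ_iff.1 i.2)⟩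
    · rintro ⟨i, -, rfl⟩
      exact ⟨_, rfl⟩

theorem Enumerates.zero_eq_nil (h : Enumerates n t v) (ht : IsTree t) : v 0 = [] := by
  obtain ⟨i, hi, h0⟩ := h.exists_index ht.1
  rcases Nat.eq_zero_or_pos i with rfl | hpos
  · exact h0
  · exact absurd (h0 ▸ h.1 0 i hpos hi) (List.not_lt_nil _)

theorem Enumerates.ne_nil (h : Enumerates n t v) {i : ℕ} (hpos : 0 < i) (hi : i ≤ n) :
    v i ≠ [] := fun h0 => List.not_lt_nil _ (h0 ▸ h.1 0 i hpos hi)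

theorem Enumerates.exists_parent (h : Enumerates n t v) (ht : IsTree t) {j : ℕ} (hpos : 0 < j)
    (hj : j ≤ n) : ∃ p < j, ∃ c, v j = v p ++ [c] := by
  obtain ⟨u, c, huc⟩ := (List.eq_nil_or_concat (v j)).resolve_left (h.ne_nil hpos hj)
  rw [List.concat_eq_append] at huc
  have hu : u ∈ t := ht.2.1 u [c] (huc ▸ h.mem hj)
  obtain ⟨p, hp, rfl⟩ := h.exists_index hu
  refine ⟨p, (h.lt_iff hp hj).1 ?_, c, huc⟩
  rw [huc]
  exact lt_append_cons _ _ _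

theorem Enumerates.phi213_eq (h : Enumerates n t v) (ht : IsTree t) {i : ℕ} (hpos : 1 ≤ i)
    (hi : i ≤ n) : phi213 t v i = (mirrorRank t (v i) : ℕ∞) := by
  have hlt : (i : ℕ∞) < t.encard := by
    rw [h.encard_eq]
    exact_mod_cast Nat.lt_succ_iff.2 hi
  have hkey := ncard_diff_fringe_add_length ht h.finite (h.mem hi)
  rw [h.ncard_setOf_lt hi] at hkey
  rw [phi213, if_pos ⟨hpos, hlt⟩, ← (h.finite.subset Set.sdiff_subset).cast_ncard_eq,
    ← Nat.cast_add, hkey, ← ENat.natCast_sub, Nat.add_sub_cancel]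

theorem Enumerates.mirrorRank_pos (h : Enumerates n t v) {i : ℕ} (hpos : 0 < i) (hi : i ≤ n) :
    0 < mirrorRank t (v i) :=
  (Set.ncard_pos (h.finite.subset fun _ hx => hx.1)).2 ⟨v i, h.mem hi, h.ne_nil hpos hi, le_rfl⟩

theorem Enumerates.mirrorRank_le (h : Enumerates n t v) (ht : IsTree t) (u : Vertex) :
    mirrorRank t u ≤ n := by
  have hlt : mirrorRank t u < t.ncard :=
    Set.ncard_lt_ncard ⟨fun x hx => hx.1, fun hsub => (hsub ht.1).2.1 rfl⟩ h.finite
  have hc : t.ncard = n + 1 := by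
    have := h.encard_eq
    rw [← h.finite.cast_ncard_eq] at this
    exact_mod_cast this
  omega

theorem Enumerates.mirrorRank_lt_iff (h : Enumerates n t v) {i j : ℕ} (hpos : 0 < i)
    (hij : i < j) (hj : j ≤ n) :
    mirrorRank t (v i) < mirrorRank t (v j) ↔ v i <+: v j := by
  rw [AvoidPaper.mirrorRank_lt_iff h.finite (h.mem (hij.le.trans hj)) (h.mem hj)
    (h.ne_nil hpos (hij.le.trans hj)) (h.ne_nil (hpos.trans hij) hj),
    mirror_lt_mirror_iff_of_lt (h.1 i j hij hj)]

theorem Enumerates.prefix_of_between (h : Enumerates n t v) {i j k : ℕ}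
    (hij : i < j) (hjk : j < k) (hk : k ≤ n) (hp : v i <+: v k) : v i <+: v j := by
  obtain ⟨w, hw⟩ := hp
  have h1 := h.1 i j hij (hjk.le.trans hk)
  have h2 := h.1 j k hjk hk
  rw [← hw] at h2
  clear hw
  revert h1 h2
  generalize v i = a
  generalize v j = b
  intro h1 h2
  induction a generalizing b with
  | nil => exact List.nil_prefix
  | cons x a ih =>
    cases b with
    | nil => exact absurd h1 (List.not_lt_nil _)
    | cons y b =>
      simp only [List.cons_append, List.cons_lt_cons_iff] at h1 h2
      have hxy : x = y := by omega
      subst hxy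
      simp only [lt_irrefl, false_or, true_and] at h1 h2
      exact List.cons_prefix_cons.2 ⟨rfl, ih b h1 h2⟩

/-- A tree is determined by the ancestor relation on the positions of its vertices. -/
theorem Enumerates.eq_of_prefix_iff {t' : Set Vertex} {v' : ℕ → Vertex}
    (h : Enumerates n t v) (h' : Enumerates n t' v') (ht : IsTree t) (ht' : IsTree t')
    (hiff : ∀ i j, 0 < i → i < j → j ≤ n → (v i <+: v j ↔ v' i <+: v' j)) : t = t' := by
  have hroot := h.zero_eq_nil ht
  have hroot' := h'.zero_eq_nil ht'
  have hiff0 : ∀ i j, i < j → j ≤ n → (v i <+: v j ↔ v' i <+: v' j) := by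
    intro i j hij hj
    rcases Nat.eq_zero_or_pos i with rfl | hpos
    · simp [hroot, hroot']
    · exact hiff i j hpos hij hj
  have hle : ∀ (u : ℕ → Vertex) (p q j c : ℕ), u j = u q ++ [c] → u p ≠ u j → u p <+: u j →
      u p <+: u q := by
    intro u p q j c hq hne hp
    rw [hq] at hp hne
    exact (List.prefix_concat_iff.1 (by simpa using hp)).resolve_left (by simpa using hne)
  have heq : ∀ j ≤ n, v j = v' j := by
    intro j
    induction j using Nat.strong_induction_on with
    | _ j ih =>
      intro hj
      rcases Nat.eq_zero_or_pos j with rfl | hpos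
      · rw [hroot, hroot']
      obtain ⟨p, hpj, c, hc⟩ := h.exists_parent ht hpos hj
      obtain ⟨q, hqj, d, hd⟩ := h'.exists_parent ht' hpos hj
      have hp := ih p hpj (hpj.le.trans hj)
      have hq := ih q hqj (hqj.le.trans hj)
      have h1 : v' p <+: v' q := hle v' p q j d hd (h'.1 p j hpj hj).ne
        ((hiff0 p j hpj hj).1 (hc ▸ List.prefix_append _ _))
      have h2 : v q <+: v p := hle v q p j c hc (h.1 q j hqj hj).ne
        ((hiff0 q j hqj hj).2 (hd ▸ List.prefix_append _ _))
      rw [hp, hq] at h2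
      have hpq : v' p = v' q := h1.eq_of_length (le_antisymm h1.length_le h2.length_le)
      rw [hp, hpq] at hc
      rcases lt_trichotomy c d with hcd | hcd | hcd
      · exfalso
        have hmem : v j ∈ t' := hc ▸ ht'.2.2 (v' q) d c (hd ▸ h'.mem hj) hcd.le
        obtain ⟨i, hi, hvi⟩ := h'.exists_index hmem
        have hij : i < j := (h'.lt_iff hi hj).1 (by
          rw [hvi, hc, hd]
          exact append_lt_append _ (List.cons_lt_cons_iff.2 (Or.inl hcd)))
        rw [← ih i hij hi] at hvi
        exact (h.1 i j hij hj).ne hvi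
      · rw [hc, hd, hcd]
      · exfalso
        have hmem : v' j ∈ t := hd ▸ ht.2.2 (v' q) c d (hc ▸ h.mem hj) hcd.le
        obtain ⟨i, hi, hvi⟩ := h.exists_index hmem
        have hij : i < j := (h.lt_iff hi hj).1 (by
          rw [hvi, hc, hd]
          exact append_lt_append _ (List.cons_lt_cons_iff.2 (Or.inl hcd)))
        rw [ih i hij hi] at hvi
        exact (h'.1 i j hij hj).ne hvi
  rw [h.2, h'.2]
  exact Set.image_congr heq

end Enumerates

theorem isTree_insert {t : Set Vertex} (ht : IsTree t) {u : Vertex} {c : ℕ} (hu : u ∈ t)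
    (hc : ∀ d < c, u ++ [d] ∈ t) : IsTree (insert (u ++ [c]) t) := by
  refine ⟨Or.inr ht.1, ?_, ?_⟩
  · rintro a b (hab | hab)
    · have ha : a <+: u ++ [c] := hab ▸ List.prefix_append a b
      rcases List.prefix_concat_iff.1 (by simpa using ha) with h | ⟨w, hw⟩
      · exact Or.inl (by simpa using h)
      · exact Or.inr (ht.2.1 a w (hw ▸ hu))
    · exact Or.inr (ht.2.1 a b hab)
  · rintro a i j (hai | hai) hji
    · obtain ⟨rfl, hi⟩ := List.append_inj' hai rfl
      obtain rfl : i = c := by simpa using hi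
      rcases hji.lt_or_eq with h | rfl
      · exact Or.inr (hc j h)
      · exact Or.inl rfl
    · exact Or.inr (ht.2.2 a i j hai hji)

/-- A word with a minimal first letter that avoids `213` is realised by a tree: `v i` is an
ancestor of `v j` exactly when the letters at `i < j` are increasing. -/
theorem exists_tree_of_word (r : ℕ → ℕ) (n : ℕ) (hmin : ∀ k, 0 < k → k ≤ n → r 0 < r k)
    (hinj : ∀ i j, i < j → j ≤ n → r i ≠ r j)
    (havoid : ∀ i j k, i < j → j < k → k ≤ n → r j < r i → ¬ r i < r k) :
    ∃ (t : Set Vertex) (v : ℕ → Vertex), IsTree t ∧ Enumerates n t v ∧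
      ∀ i j, i < j → j ≤ n → (v i <+: v j ↔ r i < r j) := by
  induction n with
  | zero =>
    refine ⟨{[]}, fun _ => [], ⟨rfl, ?_, ?_⟩, ⟨?_, ?_⟩, ?_⟩
    · intro u w h
      exact (List.append_eq_nil_iff.1 h).1
    · intro u i j h
      simp at h
    · intro i j hij hj
      omega
    · ext x
      simp
    · intro i j hij hj
      omega
  | succ n ih =>
    obtain ⟨t, v, ht, he, hv⟩ := ih (fun k h0 hk => hmin k h0 (by omega))
      (fun i j hij hj => hinj i j hij (by omega))
      (fun i j k hij hjk hk => havoid i j k hij hjk (by omega))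
    let p := Nat.findGreatest (fun i => r i < r (n + 1)) n
    have hpn : p ≤ n := Nat.findGreatest_le n
    have hp : r p < r (n + 1) :=
      Nat.findGreatest_spec (P := fun i => r i < r (n + 1)) (Nat.zero_le n)
        (hmin (n + 1) (by omega) le_rfl)
    have hgt : ∀ j, p < j → j ≤ n → r (n + 1) < r j := by
      intro j hpj hj
      have h1 := Nat.findGreatest_is_greatest (P := fun i => r i < r (n + 1)) hpj hj
      have h2 := hinj j (n + 1) (by omega) le_rfl
      omega
    have hex : ∃ c, v p ++ [c] ∉ t := by
      by_contra! hall
      refine Set.infinite_of_injective_forall_mem (f := fun c : ℕ => v p ++ [c]) ?_ hall he.finite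
      intro a b hab
      simpa using hab
    classical
    let c := Nat.find hex
    have hcnot : v p ++ [c] ∉ t := Nat.find_spec hex
    have hclt : ∀ d < c, v p ++ [d] ∈ t := fun d hd => not_not.1 (Nat.find_min hex hd)
    have hlast : ∀ i ≤ n, v i < v p ++ [c] := by
      intro i hi
      have hpnew : v p < v p ++ [c] := lt_append_cons _ _ _
      rcases lt_trichotomy i p with hip | rfl | hip
      · exact (he.1 i p hip hpn).trans hpnew
      · exact hpnew
      · obtain ⟨w, hw⟩ := (hv p i hip hi).2 (hp.trans (hgt i hip hi))
        cases w with
        | nil =>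
          rw [List.append_nil] at hw
          exact absurd hw (he.1 p i hip hi).ne
        | cons d w =>
          have hd : v p ++ [d] ∈ t := ht.2.1 _ w (by simpa [hw] using he.mem hi)
          have hdc : d < c := by
            by_contra hcd
            exact hcnot (ht.2.2 _ d c hd (not_lt.1 hcd))
          rw [← hw]
          exact append_lt_append _ (List.cons_lt_cons_iff.2 (Or.inl hdc))
    let v' := Function.update v (n + 1) (v p ++ [c])
    have hold : ∀ i ≤ n, v' i = v i := fun i hi =>
      Function.update_of_ne (by omega) _ _
    have hnew : v' (n + 1) = v p ++ [c] := Function.update_self _ _ _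
    refine ⟨insert (v p ++ [c]) t, v', isTree_insert ht (he.mem hpn) hclt, ⟨?_, ?_⟩, ?_⟩
    · intro i j hij hj
      rcases Nat.le_succ_iff.1 hj with hj' | rfl
      · rw [hold i (by omega), hold j hj']
        exact he.1 i j hij hj'
      · rw [hnew, hold i (by omega)]
        exact hlast i (by omega)
    · ext x
      simp only [Set.mem_insert_iff, Set.mem_image, Set.mem_ofPred_eq]
      constructor
      · rintro (rfl | hx)
        · exact ⟨n + 1, le_rfl, hnew⟩
        · obtain ⟨i, hi, rfl⟩ := he.exists_index hx
          exact ⟨i, by omega, hold i hi⟩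
      · rintro ⟨i, hi, rfl⟩
        rcases Nat.le_succ_iff.1 hi with hi' | rfl
        · exact Or.inr (hold i hi' ▸ he.mem hi')
        · exact Or.inl hnew
    · intro i j hij hj
      rcases Nat.le_succ_iff.1 hj with hj' | rfl
      · rw [hold i (by omega), hold j hj']
        exact hv i j hij hj'
      · have hi : i ≤ n := by omega
        rw [hnew, hold i hi]
        have hpre : v i <+: v p ++ [c] ↔ v i <+: v p := by
          refine ⟨fun h => ?_, fun h => h.trans (List.prefix_append _ _)⟩
          exact (List.prefix_concat_iff.1 (by simpa using h)).resolve_left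
            (by simpa using (hlast i hi).ne)
        rw [hpre]
        rcases lt_trichotomy i p with hip | rfl | hip
        · rw [hv i p hip hpn]
          refine ⟨fun h => h.trans hp, fun h => ?_⟩
          by_contra hc
          have hne := hinj i p hip (by omega)
          exact havoid i p (n + 1) hip (by omega) le_rfl (by omega) h
        · exact iff_of_true List.prefix_rfl hp
        · exact iff_of_false (fun h => (le_of_prefix h).not_gt (he.1 p i hip hi))
            (hgt i hip hi).not_gt

theorem avoidsPat_p213_iff {n : ℕ} (π : Equiv.Perm (Fin n)) :
    AvoidsPat π p213 ↔ ∀ i j k, i < j → j < k → π j < π i → ¬ π i < π k := by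
  constructor
  · intro h i j k hij hjk hji hik
    refine h ⟨![i, j, k], ?_, ?_⟩
    · intro a b hab
      fin_cases a <;> fin_cases b <;> simp at hab ⊢ <;> first | assumption | exact hij.trans hjk
    · have hjk' := hji.trans hik
      intro a b
      fin_cases a <;> fin_cases b <;>
        simp [p213, hji, hik, hjk', hji.not_gt, hik.not_gt, hjk'.not_gt]
  · rintro h ⟨f, hf, hiff⟩
    refine h (f 0) (f 1) (f 2) (hf (by decide)) (hf (by decide)) ((hiff 1 0).1 ?_)
      ((hiff 0 2).1 ?_)
    · simp [p213]
    · simp [p213]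

theorem perm_eq_of_lt_iff {n : ℕ} {π σ : Equiv.Perm (Fin n)}
    (h : ∀ i j, i < j → (π i < π j ↔ σ i < σ j)) : π = σ := by
  have hall : ∀ i j, π i < π j ↔ σ i < σ j := by
    intro i j
    rcases lt_trichotomy i j with hij | rfl | hij
    · exact h i j hij
    · simp
    · have h1 := h j i hij
      have h2 : π i ≠ π j := π.injective.ne hij.ne'
      have h3 : σ i ≠ σ j := σ.injective.ne hij.ne'
      rw [← not_iff_not, not_lt, not_lt, h2.symm.le_iff_lt, h3.symm.le_iff_lt, h1]
  have hmono : StrictMono (σ.symm.trans π) := by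
    intro a b hab
    simpa using (hall (σ.symm a) (σ.symm b)).2 (by simpa using hab)
  have hid : hmono.orderIsoOfSurjective _ (σ.symm.trans π).surjective = OrderIso.refl (Fin n) :=
    Subsingleton.elim _ _
  ext i
  have := DFunLike.congr_fun hid (σ i)
  simpa using congrArg Fin.val this



/-- The map `t ↦ Φ_t^{213}`, `Φ_t^{213}(i) = |t ∖ t_{v_i}| - i + |v_i|`,
is a bijection from trees with `n+1` vertices onto `Av_n(213)`. -/
theorem bijection_213 (n : ℕ) :
    (∀ t : TreeN n, ∃ v : ℕ → Vertex, IsLexEnum t.1 v) ∧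
    (∀ t : TreeN n, ∀ v : ℕ → Vertex, IsLexEnum t.1 v →
      ∃! π : Equiv.Perm (Fin n), ∀ i : Fin n,
        (((π i : ℕ) + 1 : ℕ) : ℕ∞) = phi213 t.1 v ((i : ℕ) + 1)) ∧
    (∀ Φ : TreeN n → Equiv.Perm (Fin n),
      (∀ t : TreeN n, ∀ v : ℕ → Vertex, IsLexEnum t.1 v → ∀ i : Fin n,
        (((Φ t i : ℕ) + 1 : ℕ) : ℕ∞) = phi213 t.1 v ((i : ℕ) + 1)) →
      Set.BijOn Φ Set.univ {π : Equiv.Perm (Fin n) | AvoidsPat π p213}) := by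
  have hexists : ∀ t : TreeN n, ∃ v : ℕ → Vertex, IsLexEnum t.1 v := fun t =>
    (exists_enumerates t.2.2).imp fun _ h => h.isLexEnum
  refine ⟨hexists, ?_, ?_⟩
  · intro t v hlex
    have he := hlex.enumerates t.2.2
    have ht := t.2.1
    have hpos : ∀ i : Fin n, 0 < mirrorRank t.1 (v (i + 1)) := fun i =>
      he.mirrorRank_pos (Nat.succ_pos _) i.2
    let f : Fin n → Fin n := fun i =>
      ⟨mirrorRank t.1 (v (i + 1)) - 1, by
        have h1 := hpos i
        have h2 := he.mirrorRank_le ht (v (i + 1))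
        omega⟩
    have hf : Function.Injective f := by
      intro i j hij
      have h1 := hpos i
      have h2 := hpos j
      have h3 : mirrorRank t.1 (v (i + 1)) = mirrorRank t.1 (v (j + 1)) := by
        have := congrArg Fin.val hij
        simp only [f] at this
        omega
      have hm : ∀ a : Fin n, v (a + 1) ∈ t.1 := fun a => he.mem a.2
      have h0 : ∀ a : Fin n, v (a + 1) ≠ [] := fun a => he.ne_nil (Nat.succ_pos _) a.2
      have h4 := mirrorRank_lt_iff he.finite (hm i) (hm j) (h0 i) (h0 j)
      have h5 := mirrorRank_lt_iff he.finite (hm j) (hm i) (h0 j) (h0 i)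
      rw [h3] at h4 h5
      have h6 : v (i + 1) = v (j + 1) := mirror_injective
        (le_antisymm (not_lt.1 fun h => (h5.2 h).false) (not_lt.1 fun h => (h4.2 h).false))
      have := he.injOn (show (i : ℕ) + 1 ≤ n from i.2) (show (j : ℕ) + 1 ≤ n from j.2) h6
      exact Fin.ext (by omega)
    refine ⟨Equiv.ofBijective f (Finite.injective_iff_bijective.1 hf), ?_, ?_⟩
    · intro i
      rw [he.phi213_eq ht (Nat.succ_pos _) i.2]
      have h1 := hpos i
      simp only [Equiv.ofBijective_apply, f]
      rw [Nat.sub_add_cancel h1]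
    · intro σ hσ
      ext i
      have h1 := hpos i
      have h2 := hσ i
      rw [he.phi213_eq ht (Nat.succ_pos _) i.2] at h2
      have h3 : (σ i : ℕ) + 1 = mirrorRank t.1 (v (i + 1)) := by exact_mod_cast h2
      simp only [Equiv.ofBijective_apply, f]
      omega
  · intro Φ hΦ
    have hord : ∀ (t : TreeN n) (v : ℕ → Vertex), Enumerates n t.1 v → ∀ i j : Fin n, i < j →
        (Φ t i < Φ t j ↔ v (i + 1) <+: v (j + 1)) := by
      intro t v he i j hij
      have hval : ∀ a : Fin n, (Φ t a : ℕ) + 1 = mirrorRank t.1 (v (a + 1)) := by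
        intro a
        have := hΦ t v he.isLexEnum a
        rw [he.phi213_eq t.2.1 (Nat.succ_pos _) a.2] at this
        exact_mod_cast this
      have hij' : (i : ℕ) + 1 < j + 1 := Nat.succ_lt_succ hij
      rw [← he.mirrorRank_lt_iff (Nat.succ_pos _) hij' j.2, ← hval, ← hval, Fin.lt_def]
      omega
    refine ⟨?_, ?_, ?_⟩
    · intro t _
      obtain ⟨v, he⟩ := exists_enumerates t.2.2
      refine (avoidsPat_p213_iff _).2 fun i j k hij hjk hji hik => ?_
      have hpre := (hord t v he i k (hij.trans hjk)).1 hik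
      refine hji.not_gt ((hord t v he i j hij).2 ?_)
      exact he.prefix_of_between (Nat.succ_lt_succ hij) (Nat.succ_lt_succ hjk) k.2 hpre
    · intro t _ t' _ heq
      obtain ⟨v, he⟩ := exists_enumerates t.2.2
      obtain ⟨v', he'⟩ := exists_enumerates t'.2.2
      refine Subtype.ext (he.eq_of_prefix_iff he' t.2.1 t'.2.1 fun i j hpos hij hj => ?_)
      obtain ⟨i, rfl⟩ : ∃ a, i = a + 1 := ⟨i - 1, by omega⟩
      obtain ⟨j, rfl⟩ : ∃ a, j = a + 1 := ⟨j - 1, by omega⟩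
      have hij' : (⟨i, by omega⟩ : Fin n) < ⟨j, by omega⟩ := Nat.lt_of_succ_lt_succ hij
      have h1 := hord t v he _ _ hij'
      have h2 := hord t' v' he' _ _ hij'
      rw [heq] at h1
      exact h1.symm.trans h2
    · intro π hπ
      rw [Set.mem_ofPred_eq, avoidsPat_p213_iff] at hπ
      let r : ℕ → ℕ := fun k => if h : 0 < k ∧ k ≤ n then π ⟨k - 1, by omega⟩ + 1 else 0
      have hr : ∀ k (h0 : 0 < k) (hk : k ≤ n), r k = π ⟨k - 1, by omega⟩ + 1 :=
        fun k h0 hk => dif_pos ⟨h0, hk⟩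
      have hr0 : r 0 = 0 := dif_neg (by omega)
      have hmin : ∀ k, 0 < k → k ≤ n → r 0 < r k := fun k h0 hk => by
        rw [hr0, hr k h0 hk]
        omega
      obtain ⟨t, v, ht, he, hv⟩ := exists_tree_of_word r n hmin (by
          intro i j hij hj heq
          rcases Nat.eq_zero_or_pos i with rfl | hi
          · exact (hmin j hij hj).ne heq
          · rw [hr i hi (by omega), hr j (by omega) hj, Nat.add_right_cancel_iff,
              Fin.val_inj, π.injective.eq_iff, Fin.mk.injEq] at heq
            omega) (by
          intro i j k hij hjk hk hji hik
          rcases Nat.eq_zero_or_pos i with rfl | hi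
          · omega
          · rw [hr i hi (by omega), hr j (by omega) (by omega)] at hji
            rw [hr i hi (by omega), hr k (by omega) hk] at hik
            refine hπ ⟨i - 1, by omega⟩ ⟨j - 1, by omega⟩ ⟨k - 1, by omega⟩ ?_ ?_
              (Nat.lt_of_succ_lt_succ hji) (Nat.lt_of_succ_lt_succ hik)
            · rw [Fin.mk_lt_mk]
              omega
            · rw [Fin.mk_lt_mk]
              omega)
      let T : TreeN n := ⟨t, ht, he.encard_eq⟩
      refine ⟨T, Set.mem_univ _, perm_eq_of_lt_iff fun i j hij => ?_⟩
      rw [hord T v he i j hij, hv _ _ (Nat.succ_lt_succ hij) j.2, hr _ (Nat.succ_pos _) i.2,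
        hr _ (Nat.succ_pos _) j.2]
      simp

end AvoidPaper
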